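/- The language inclusion problem for TOPL automata is undecidable: taking V = ℕ (so that automata admit finite descriptions), the set of pairs (A₁, A₂) of TOPL automata over V^n with L(A₁) ⊆ L(A₂) is not a computable predicate on (codes of) pairs of automata; i.e. there is no algorithm that, given TOPL automata A₁ and A₂, decides whether L(A₁) ⊆ L(A₂). -/

import Mathlib

namespace Topl

/-- A (code for a) guard: a finite conjunction of literals `(b, i, j)`, where `b = true`
means `eq i j` (register `i` equals component `j` of the letter), `b = false` means
`neq i j`, and the empty conjunction is the guard `true`. -/
abbrev GuardC : Type := List (Bool × ℕ × ℕ)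

/-- A (code for an) action: a finite sequence of assignments `set i := j`;
the empty sequence is `nop`. -/
abbrev ActionC : Type := List (ℕ × ℕ)

/-- A code for a TOPL automaton over `V = ℕ`, with `m` registers, arity `n`,
states `{0, …, k−1}`, initial state `q0`, initial store `s0`,
transition list `delta` and final states `F`. -/
structure ToplC where
  m : ℕ
  n : ℕ
  k : ℕ
  q0 : ℕ
  s0 : List ℕ
  delta : List (ℕ × (GuardC × ActionC) × ℕ)
  F : List ℕ

def toplCEquiv : ToplC ≃ ℕ × ℕ × ℕ × ℕ × List ℕ × List (ℕ × (GuardC × ActionC) × ℕ) × List ℕ where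
  toFun A := (A.m, A.n, A.k, A.q0, A.s0, A.delta, A.F)
  invFun p := ⟨p.1, p.2.1, p.2.2.1, p.2.2.2.1, p.2.2.2.2.1, p.2.2.2.2.2.1, p.2.2.2.2.2.2⟩
  left_inv A := rfl
  right_inv p := rfl

instance : Primcodable ToplC := Primcodable.ofEquiv _ toplCEquiv

/-- Satisfaction of a guard by a store `s` and a letter `ℓ` (both given as lists). -/
def GuardC.Sat (s ℓ : List ℕ) (g : GuardC) : Prop :=
  ∀ p ∈ g, (p.1 = true → s.getD p.2.1 0 = ℓ.getD p.2.2 0) ∧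
           (p.1 = false → s.getD p.2.1 0 ≠ ℓ.getD p.2.2 0)

/-- The store transformation of an action on input letter `ℓ`. -/
def ActionC.run (ℓ : List ℕ) (a : ActionC) (s : List ℕ) : List ℕ :=
  a.foldl (fun s p => s.set p.1 (ℓ.getD p.2 0)) s

/-- One edge of the configuration graph. -/
def ToplC.Step (A : ToplC) (x₁ : ℕ × List ℕ) (ℓ : List ℕ) (x₂ : ℕ × List ℕ) : Prop :=
  ∃ g a, (x₁.1, (g, a), x₂.1) ∈ A.delta ∧ GuardC.Sat x₁.2 ℓ g ∧ ActionC.run ℓ a x₁.2 = x₂.2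

/-- Walks in the configuration graph, labelled by words. -/
inductive ToplC.Reach (A : ToplC) : ℕ × List ℕ → List (List ℕ) → ℕ × List ℕ → Prop
  | nil (x) : ToplC.Reach A x [] x
  | cons {x₁ x₂ x₃ ℓ w} : A.Step x₁ ℓ x₂ → ToplC.Reach A x₂ w x₃ → ToplC.Reach A x₁ (ℓ :: w) x₃

/-- The language of a coded TOPL automaton: words over the alphabet `ℕ^n`
(letters are lists of length `n`) labelling walks from the initial configuration
to a configuration whose state is final. -/
def ToplC.Lang (A : ToplC) : Set (List (List ℕ)) :=
  { w | (∀ ℓ ∈ w, ℓ.length = A.n) ∧ ∃ x, A.Reach (A.q0, A.s0) w x ∧ x.1 ∈ A.F }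

/-- Well-formedness: the code really describes a TOPL automaton with `m` registers over
`n`-tuples and `k` states. -/
def ToplC.WF (A : ToplC) : Prop :=
  A.q0 < A.k ∧ A.s0.length = A.m ∧ (∀ q ∈ A.F, q < A.k) ∧
  ∀ t ∈ A.delta, t.1 < A.k ∧ t.2.2 < A.k ∧
    (∀ p ∈ t.2.1.1, p.2.1 < A.m ∧ p.2.2 < A.n) ∧
    (∀ p ∈ t.2.1.2, p.1 < A.m ∧ p.2 < A.n)

/-- All words over the alphabet `ℕ^n`. -/
def fullLang (n : ℕ) : Set (List (List ℕ)) := { w | ∀ ℓ ∈ w, ℓ.length = n }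

/-! ### Horn rules over the natural numbers -/

/-- A Horn clause whose head is `rel args` and whose body is a list of atoms; the entries of
`args` and of the argument lists in the body are variables. -/
structure Rule where
  rel : Set (List ℕ)
  args : List ℕ
  body : List (Set (List ℕ) × List ℕ)

/-- The clause holds under every assignment of natural numbers to the variables. -/
def Rule.Sound (r : Rule) : Prop :=
  ∀ σ : ℕ → ℕ, (∀ b ∈ r.body, b.2.map σ ∈ b.1) → r.args.map σ ∈ r.rel

def zeroRel : Set (List ℕ) := {l | l = [0]}

def succRel : Set (List ℕ) := {l | ∃ x, l = [x + 1, x]}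

/-- Facts derivable by the rules `R` from the graphs of zero and successor. -/
inductive Derives (R : List Rule) : Set (List ℕ) → List ℕ → Prop
  | zero : Derives R zeroRel [0]
  | succ (x : ℕ) : Derives R succRel [x + 1, x]
  | rule (r : Rule) (hr : r ∈ R) (σ : ℕ → ℕ) :
      (∀ b ∈ r.body, Derives R b.1 (b.2.map σ)) → Derives R r.rel (r.args.map σ)

theorem Derives.mono {R R' : List Rule} (h : R ⊆ R') {P xs} (d : Derives R P xs) :
    Derives R' P xs := by
  induction d with
  | zero => exact .zero
  | succ x => exact .succ x
  | rule r hr σ _ ih => exact .rule r (h hr) σ ih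

/-- `P` is derivable from finitely many sound rules. -/
def Definable (P : Set (List ℕ)) : Prop :=
  ∃ R : List Rule, (∀ r ∈ R, r.Sound) ∧ ∀ xs ∈ P, Derives R P xs

/-- Finitely many definable relations can be derived from one common set of rules. -/
theorem exists_common_rules (L : List (Set (List ℕ))) (h : ∀ P ∈ L, Definable P) :
    ∃ R : List Rule, (∀ r ∈ R, r.Sound) ∧ ∀ P ∈ L, ∀ xs ∈ P, Derives R P xs := by
  induction L with
  | nil => exact ⟨[], by simp, by simp⟩
  | cons P L ih =>
    obtain ⟨R, hR, hd⟩ := ih fun Q hQ => h Q (List.mem_cons_of_mem _ hQ)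
    obtain ⟨R', hR', hd'⟩ := h P List.mem_cons_self
    refine ⟨R' ++ R, ?_, ?_⟩
    · intro r hr
      rcases List.mem_append.1 hr with hr | hr
      exacts [hR' r hr, hR r hr]
    · intro Q hQ xs hxs
      rcases List.mem_cons.1 hQ with rfl | hQ
      · exact (hd' xs hxs).mono (List.subset_append_left _ _)
      · exact (hd Q hQ xs hxs).mono (List.subset_append_right _ _)

/-- To define `P`, it suffices to derive it by sound rules from relations already defined. -/
theorem Definable.of_rules {P : Set (List ℕ)} (L : List (Set (List ℕ))) (S : List Rule)
    (hL : ∀ Q ∈ L, Definable Q) (hS : ∀ r ∈ S, r.Sound)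
    (h : ∀ R : List Rule, S ⊆ R → (∀ Q ∈ L, ∀ xs ∈ Q, Derives R Q xs) →
      ∀ xs ∈ P, Derives R P xs) : Definable P := by
  obtain ⟨R, hR, hd⟩ := exists_common_rules L hL
  refine ⟨S ++ R, ?_, h _ (List.subset_append_left _ _) fun Q hQ xs hxs =>
    (hd Q hQ xs hxs).mono (List.subset_append_right _ _)⟩
  intro r hr
  rcases List.mem_append.1 hr with hr | hr
  exacts [hS r hr, hR r hr]

/-- The assignment whose first values are listed. -/
def assign (l : List ℕ) (i : ℕ) : ℕ := l.getD i 0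

theorem Derives.of_rule {R : List Rule} {P : Set (List ℕ)} {xs : List ℕ} (l : List ℕ) (r : Rule)
    (hr : r ∈ R) (h : ∀ b ∈ r.body, Derives R b.1 (b.2.map (assign l))) (hP : r.rel = P)
    (hxs : r.args.map (assign l) = xs) : Derives R P xs := by
  subst hP hxs
  exact .rule r hr _ h

def addRel : Set (List ℕ) := {l | ∃ x y, l = [x, y, x + y]}

def mulRel : Set (List ℕ) := {l | ∃ x y, l = [x, y, x * y]}

def pairRel : Set (List ℕ) := {l | ∃ x y, l = [x, y, Nat.pair x y]}

def graph (f : ℕ → ℕ) : Set (List ℕ) := {l | ∃ x, l = [x, f x]}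

theorem definable_addRel : Definable addRel := by
  refine .of_rules [] [⟨addRel, [0, 1, 0], [(zeroRel, [1])]⟩,
    ⟨addRel, [0, 1, 2], [(succRel, [1, 3]), (addRel, [0, 3, 4]), (succRel, [2, 4])]⟩]
    (by simp) ?_ ?_
  · simp only [List.mem_cons, List.not_mem_nil, or_false, forall_eq_or_imp, forall_eq]
    refine ⟨fun σ => ?_, fun σ => ?_⟩
    · simp +contextual [zeroRel, addRel]
    · simp [succRel, addRel]
      omega
  · rintro R hR - _ ⟨x, y, rfl⟩
    simp only [List.cons_subset, List.nil_subset, and_true] at hR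
    induction y with
    | zero => exact .of_rule [x, 0] _ hR.1 (by simp [assign, Derives.zero]) rfl (by simp [assign])
    | succ y ih =>
      have : Derives R succRel [x + (y + 1), x + y] := .succ (x + y)
      exact .of_rule [x, y + 1, x + (y + 1), y, x + y] _ hR.2
        (by simp [assign, ih, Derives.succ, this]) rfl (by simp [assign])

theorem definable_mulRel : Definable mulRel := by
  refine .of_rules [addRel] [⟨mulRel, [0, 1, 1], [(zeroRel, [1])]⟩,
    ⟨mulRel, [0, 1, 2], [(succRel, [1, 3]), (mulRel, [0, 3, 4]), (addRel, [4, 0, 2])]⟩]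
    (by simp [definable_addRel]) ?_ ?_
  · simp only [List.mem_cons, List.not_mem_nil, or_false, forall_eq_or_imp, forall_eq]
    refine ⟨fun σ => ?_, fun σ => ?_⟩
    · simp +contextual [zeroRel, mulRel]
    · simp only [succRel, mulRel, addRel]
      simp
      intro h1 h2 h3
      rw [h3, h2, h1, Nat.mul_succ]
  · rintro R hR hL _ ⟨x, y, rfl⟩
    simp only [List.cons_subset, List.nil_subset, and_true] at hR
    simp only [List.mem_cons, List.not_mem_nil, or_false, forall_eq] at hL
    induction y with
    | zero => exact .of_rule [x, 0] _ hR.1 (by simp [assign, Derives.zero]) rfl (by simp [assign])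
    | succ y ih =>
      have := hL [x * y, x, x * y + x] ⟨_, _, rfl⟩
      exact .of_rule [x, y + 1, x * y + x, y, x * y] _ hR.2
        (by simp [assign, ih, Derives.succ, this]) rfl (by simp [assign, Nat.mul_succ])

theorem definable_pairRel : Definable pairRel := by
  refine .of_rules [addRel, mulRel]
    [⟨pairRel, [0, 1, 2], [(addRel, [0, 3, 4]), (succRel, [1, 4]), (mulRel, [1, 1, 5]),
      (addRel, [5, 0, 2])]⟩,
    ⟨pairRel, [0, 1, 2], [(addRel, [1, 3, 0]), (mulRel, [0, 0, 4]), (addRel, [4, 0, 5]),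
      (addRel, [5, 1, 2])]⟩]
    (by simp [definable_addRel, definable_mulRel]) ?_ ?_
  · simp only [List.mem_cons, List.not_mem_nil, or_false, forall_eq_or_imp, forall_eq]
    refine ⟨fun σ => ?_, fun σ => ?_⟩
    · simp only [succRel, pairRel, mulRel, addRel, Nat.pair]
      simp
      intro h1 h2 h3 h4
      rw [if_pos (by omega), h4, h3]
    · simp only [pairRel, mulRel, addRel, Nat.pair]
      simp
      intro h1 h2 h3 h4
      rw [if_neg (by omega), h4, h3, h2]
  · rintro R hR hL _ ⟨x, y, rfl⟩
    simp only [List.cons_subset, List.nil_subset, and_true] at hR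
    simp only [List.mem_cons, List.not_mem_nil, or_false, forall_eq_or_imp, forall_eq] at hL
    obtain ⟨hadd, hmul⟩ := hL
    by_cases hxy : x < y
    · obtain ⟨d, rfl⟩ := Nat.exists_eq_add_of_lt hxy
      refine .of_rule [x, x + d + 1, Nat.pair x (x + d + 1), d, x + d, (x + d + 1) * (x + d + 1)]
        _ hR.1 ?_ rfl (by simp [assign])
      simp only [List.mem_cons, List.not_mem_nil, or_false, forall_eq_or_imp, forall_eq]
      exact ⟨hadd _ ⟨_, _, rfl⟩, .succ _, hmul _ ⟨_, _, rfl⟩,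
        hadd _ ⟨(x + d + 1) * (x + d + 1), x, by simp [assign, Nat.pair, hxy]⟩⟩
    · obtain ⟨d, rfl⟩ := Nat.exists_eq_add_of_le (not_lt.1 hxy)
      refine .of_rule [y + d, y, Nat.pair (y + d) y, d, (y + d) * (y + d),
        (y + d) * (y + d) + (y + d)] _ hR.2 ?_ rfl (by simp [assign])
      simp only [List.mem_cons, List.not_mem_nil, or_false, forall_eq_or_imp, forall_eq]
      exact ⟨hadd _ ⟨_, _, rfl⟩, hmul _ ⟨_, _, rfl⟩, hadd _ ⟨_, _, rfl⟩,
        hadd _ ⟨(y + d) * (y + d) + (y + d), y, by simp [assign, Nat.pair]⟩⟩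

/-- The graph of the function of two arguments defined by primitive recursion. -/
def recRel (f g : ℕ → ℕ) : Set (List ℕ) :=
  {l | ∃ z n, l = [z, n, n.rec (f z) fun y ih => g (Nat.pair z (Nat.pair y ih))]}

theorem definable_recRel {f g : ℕ → ℕ} (hf : Definable (graph f)) (hg : Definable (graph g)) :
    Definable (recRel f g) := by
  refine .of_rules [pairRel, graph f, graph g]
    [⟨recRel f g, [0, 1, 2], [(zeroRel, [1]), (graph f, [0, 2])]⟩,
     ⟨recRel f g, [0, 1, 2], [(succRel, [1, 3]), (recRel f g, [0, 3, 4]), (pairRel, [3, 4, 5]),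
       (pairRel, [0, 5, 6]), (graph g, [6, 2])]⟩]
    (by simp [definable_pairRel, hf, hg]) ?_ ?_
  · simp only [List.mem_cons, List.not_mem_nil, or_false, forall_eq_or_imp, forall_eq]
    refine ⟨fun σ => ?_, fun σ => ?_⟩
    · simp only [zeroRel, recRel, graph]
      simp
      intro h1 h2
      simp [h1, h2]
    · simp only [succRel, recRel, graph, pairRel]
      simp
      intro h1 h2 h3 h4 h5
      rw [h5, h4, h3, h2, h1]
  · rintro R hR hL _ ⟨z, n, rfl⟩
    simp only [List.cons_subset, List.nil_subset, and_true] at hR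
    simp only [List.mem_cons, List.not_mem_nil, or_false, forall_eq_or_imp, forall_eq] at hL
    obtain ⟨hpair, hfd, hgd⟩ := hL
    induction n with
    | zero =>
      refine .of_rule [z, 0, f z] _ hR.1 ?_ rfl rfl
      simp only [List.mem_cons, List.not_mem_nil, or_false, forall_eq_or_imp, forall_eq]
      exact ⟨.zero, hfd _ ⟨_, rfl⟩⟩
    | succ n ih =>
      set v : ℕ := n.rec (f z) fun y ih => g (Nat.pair z (Nat.pair y ih)) with hv
      refine .of_rule [z, n + 1, g (Nat.pair z (Nat.pair n v)), n, v, Nat.pair n v,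
        Nat.pair z (Nat.pair n v)] _ hR.2 ?_ rfl rfl
      simp only [List.mem_cons, List.not_mem_nil, or_false, forall_eq_or_imp, forall_eq]
      exact ⟨.succ _, ih, hpair _ ⟨_, _, rfl⟩, hpair _ ⟨_, _, rfl⟩, hgd _ ⟨_, rfl⟩⟩

theorem definable_graph {f : ℕ → ℕ} (hf : Nat.Primrec f) : Definable (graph f) := by
  induction hf with
  | zero =>
    refine .of_rules [] [⟨graph fun _ => 0, [0, 1], [(zeroRel, [1])]⟩] (by simp) ?_ ?_
    · simp only [List.mem_cons, List.not_mem_nil, or_false, forall_eq]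
      intro σ
      simp [zeroRel, graph]
    · rintro R hR - _ ⟨x, rfl⟩
      exact .of_rule [x, 0] _ (hR List.mem_cons_self) (by simp [assign, Derives.zero]) rfl rfl
  | succ =>
    refine .of_rules [] [⟨graph Nat.succ, [0, 1], [(succRel, [1, 0])]⟩] (by simp) ?_ ?_
    · simp only [List.mem_cons, List.not_mem_nil, or_false, forall_eq]
      intro σ
      simp [succRel, graph]
    · rintro R hR - _ ⟨x, rfl⟩
      exact .of_rule [x, x + 1] _ (hR List.mem_cons_self) (by simp [assign, Derives.succ]) rfl rfl
  | left =>
    refine .of_rules [pairRel] [⟨graph fun n => n.unpair.1, [0, 1], [(pairRel, [1, 2, 0])]⟩]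
      (by simp [definable_pairRel]) ?_ ?_
    · simp only [List.mem_cons, List.not_mem_nil, or_false, forall_eq]
      intro σ
      simp only [pairRel, graph]
      simp
      intro h
      simp [h]
    · rintro R hR hL _ ⟨x, rfl⟩
      refine .of_rule [x, x.unpair.1, x.unpair.2] _ (hR List.mem_cons_self) ?_ rfl rfl
      simp only [List.mem_cons, List.not_mem_nil, or_false, forall_eq] at hL ⊢
      exact hL _ ⟨x.unpair.1, x.unpair.2, by simp [assign]⟩
  | right =>
    refine .of_rules [pairRel] [⟨graph fun n => n.unpair.2, [0, 1], [(pairRel, [2, 1, 0])]⟩]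
      (by simp [definable_pairRel]) ?_ ?_
    · simp only [List.mem_cons, List.not_mem_nil, or_false, forall_eq]
      intro σ
      simp only [pairRel, graph]
      simp
      intro h
      simp [h]
    · rintro R hR hL _ ⟨x, rfl⟩
      refine .of_rule [x, x.unpair.2, x.unpair.1] _ (hR List.mem_cons_self) ?_ rfl rfl
      simp only [List.mem_cons, List.not_mem_nil, or_false, forall_eq] at hL ⊢
      exact hL _ ⟨x.unpair.1, x.unpair.2, by simp [assign]⟩
  | @pair f g _ _ hf hg =>
    refine .of_rules [pairRel, graph f, graph g]
      [⟨graph fun n => Nat.pair (f n) (g n), [0, 1],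
        [(graph f, [0, 2]), (graph g, [0, 3]), (pairRel, [2, 3, 1])]⟩]
      (by simp [definable_pairRel, hf, hg]) ?_ ?_
    · simp only [List.mem_cons, List.not_mem_nil, or_false, forall_eq]
      intro σ
      simp only [pairRel, graph]
      simp
      intro h1 h2 h3
      rw [h3, h2, h1]
    · rintro R hR hL _ ⟨x, rfl⟩
      refine .of_rule [x, Nat.pair (f x) (g x), f x, g x] _ (hR List.mem_cons_self) ?_ rfl rfl
      simp only [List.mem_cons, List.not_mem_nil, or_false, forall_eq_or_imp, forall_eq] at hL ⊢
      exact ⟨hL.2.1 _ ⟨_, rfl⟩, hL.2.2 _ ⟨_, rfl⟩, hL.1 _ ⟨_, _, rfl⟩⟩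
  | @comp f g _ _ hf hg =>
    refine .of_rules [graph f, graph g]
      [⟨graph fun n => f (g n), [0, 1], [(graph g, [0, 2]), (graph f, [2, 1])]⟩]
      (by simp [hf, hg]) ?_ ?_
    · simp only [List.mem_cons, List.not_mem_nil, or_false, forall_eq]
      intro σ
      simp only [graph]
      simp
      intro h1 h2
      rw [h2, h1]
    · rintro R hR hL _ ⟨x, rfl⟩
      refine .of_rule [x, f (g x), g x] _ (hR List.mem_cons_self) ?_ rfl rfl
      simp only [List.mem_cons, List.not_mem_nil, or_false, forall_eq_or_imp, forall_eq] at hL ⊢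
      exact ⟨hL.2 _ ⟨_, rfl⟩, hL.1 _ ⟨_, rfl⟩⟩
  | @prec f g _ _ hf hg =>
    refine .of_rules [pairRel, recRel f g]
      [⟨graph (Nat.unpaired fun z n => n.rec (f z) fun y ih => g (Nat.pair z (Nat.pair y ih))),
        [0, 1], [(pairRel, [2, 3, 0]), (recRel f g, [2, 3, 1])]⟩]
      (by simp [definable_pairRel, definable_recRel hf hg]) ?_ ?_
    · simp only [List.mem_cons, List.not_mem_nil, or_false, forall_eq]
      intro σ
      simp only [graph, pairRel, recRel]
      simp
      intro h1 h2
      rw [h2, h1, Nat.unpair_pair]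
    · rintro R hR hL _ ⟨x, rfl⟩
      refine .of_rule [x, _, x.unpair.1, x.unpair.2] _ (hR List.mem_cons_self) ?_ rfl rfl
      simp only [List.mem_cons, List.not_mem_nil, or_false, forall_eq_or_imp, forall_eq] at hL ⊢
      exact ⟨hL.1 _ ⟨x.unpair.1, x.unpair.2, by simp [assign]⟩, hL.2 _ ⟨_, _, rfl⟩⟩

/-- The codes of partial recursive functions that are defined at `0`. -/
def haltRel : Set (List ℕ) :=
  {l | ∃ c : Nat.Partrec.Code, (c.eval 0).Dom ∧ l = [Encodable.encode c]}

theorem definable_haltRel : Definable haltRel := by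
  let h : ℕ × ℕ → ℕ := fun p =>
    cond (Nat.Partrec.Code.evaln p.1 (Denumerable.ofNat Nat.Partrec.Code p.2) 0).isSome 0 1
  have hh : Primrec h := by
    refine Primrec.cond (Primrec.option_isSome.comp (Nat.Partrec.Code.primrec_evaln.comp
      ((Primrec.fst.pair ((Primrec.ofNat _).comp Primrec.snd)).pair (Primrec.const 0))))
      (Primrec.const 0) (Primrec.const 1)
  have hh' : Nat.Primrec fun n => h n.unpair := Primrec.nat_iff.1 (hh.comp Primrec.unpair)
  have key : ∀ c : Nat.Partrec.Code, (c.eval 0).Dom ↔ ∃ k, h (k, Encodable.encode c) = 0 := by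
    intro c
    simp only [h, Denumerable.ofNat_encode, Part.dom_iff_mem, Nat.Partrec.Code.evaln_complete]
    rw [exists_comm]
    refine exists_congr fun k => ?_
    cases Nat.Partrec.Code.evaln k c 0 <;> simp
  refine .of_rules [pairRel, graph fun n => h n.unpair]
    [⟨haltRel, [0], [(pairRel, [1, 0, 2]), (graph fun n => h n.unpair, [2, 3]), (zeroRel, [3])]⟩]
    (by simp [definable_pairRel, definable_graph hh']) ?_ ?_
  · simp only [List.mem_cons, List.not_mem_nil, or_false, forall_eq]
    intro σ
    simp only [graph, pairRel, zeroRel, haltRel]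
    simp
    intro h1 h2 h3
    refine ⟨Denumerable.ofNat _ (σ 0), (key _).2 ⟨σ 1, ?_⟩, by simp⟩
    rwa [Denumerable.encode_ofNat, ← Nat.unpair_pair (σ 1) (σ 0), ← h1, ← h2]
  · rintro R hR hL _ ⟨c, hc, rfl⟩
    obtain ⟨k, hk⟩ := (key c).1 hc
    refine .of_rule [Encodable.encode c, k, Nat.pair k (Encodable.encode c), 0] _
      (hR List.mem_cons_self) ?_ rfl rfl
    simp only [List.mem_cons, List.not_mem_nil, or_false, forall_eq_or_imp, forall_eq] at hL ⊢
    exact ⟨hL.1 _ ⟨_, _, rfl⟩, hL.2 _ ⟨Nat.pair k (Encodable.encode c), by simp [assign, hk]⟩,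
      .zero⟩

/-! ### Automata rejecting the words with a local structure -/

/-- A letter whose first component is `q.1` must be followed by a letter matching one of the
patterns in `q.2`: a pattern `(t, E)` asks for the first component `t` and for the equality of
component `i + 1` of the former letter and component `j + 1` of the latter for `(i, j) ∈ E`. -/
abbrev Requirement : Type := ℕ × List (ℕ × List (ℕ × ℕ))

/-- Letters start with a tag `< numTags`. Besides the requirements there are conflicts `(t, g)`:
after a letter with tag `t`, no letter may satisfy `g` in the store consisting of the tags and the
former letter. -/
structure Spec where
  numTags : ℕ
  arity : ℕ
  reqs : List Requirement
  conflicts : List (ℕ × GuardC)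

def Matches (p : ℕ × List (ℕ × ℕ)) (ℓ ℓ' : List ℕ) : Prop :=
  ℓ'.getD 0 0 = p.1 ∧ ∀ e ∈ p.2, ℓ.getD (e.1 + 1) 0 = ℓ'.getD (e.2 + 1) 0

namespace Spec

def Satisfied (S : Spec) : List (List ℕ) → Prop
  | [] => True
  | ℓ :: w => (∀ q ∈ S.reqs, ℓ.getD 0 0 = q.1 → ∃ ℓ' ∈ w, ∃ p ∈ q.2, Matches p ℓ ℓ') ∧
      (∀ c ∈ S.conflicts, ℓ.getD 0 0 = c.1 →
        ∀ ℓ' ∈ w, ¬ GuardC.Sat (List.range S.numTags ++ ℓ) ℓ' c.2) ∧ Satisfied S w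

def WF (S : Spec) : Prop :=
  0 < S.arity ∧
  (∀ q ∈ S.reqs, q.1 < S.numTags ∧ ∀ p ∈ q.2, p.1 < S.numTags ∧
    ∀ e ∈ p.2, e.1 + 1 < S.arity ∧ e.2 + 1 < S.arity) ∧
  ∀ c ∈ S.conflicts, c.1 < S.numTags ∧
    ∀ p ∈ c.2, p.2.1 < S.numTags + S.arity ∧ p.2.2 < S.arity

def reqState (q : Requirement) : ℕ := 2 * Encodable.encode q + 2

def conflictState (c : ℕ × GuardC) : ℕ := 2 * Encodable.encode c + 3

/-- The literals whose disjunction says that a letter does not match `p`. -/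
def mismatch (S : Spec) (p : ℕ × List (ℕ × ℕ)) : GuardC :=
  (false, p.1, 0) :: p.2.map fun e => (false, S.numTags + (e.1 + 1), e.2 + 1)

def load (S : Spec) : ActionC := (List.range S.arity).map fun j => (S.numTags + j, j)

/-- Conjunctions saying that a letter matches none of the patterns of `q`. -/
def mismatches (S : Spec) (q : Requirement) : List GuardC := (q.2.map S.mismatch).sections

/-- The automaton guessing a violation of the specification. -/
def refuter (S : Spec) : ToplC where
  m := S.numTags + S.arity
  n := S.arity
  k := 2 + (S.reqs.map reqState).sum + (S.conflicts.map conflictState).sum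
  q0 := 0
  s0 := List.range S.numTags ++ List.replicate S.arity 0
  delta := (0, ([], []), 0) :: (1, ([], []), 1) ::
    ((S.reqs.flatMap fun q => (0, ([(true, q.1, 0)], S.load), reqState q) ::
      (S.mismatches q).map fun g => (reqState q, (g, []), reqState q)) ++
    S.conflicts.flatMap fun c => [(0, ([(true, c.1, 0)], S.load), conflictState c),
      (conflictState c, ([], []), conflictState c), (conflictState c, (c.2, []), 1)])
  F := 1 :: S.reqs.map reqState

end Spec

theorem getD_range_append_of_lt {T t : ℕ} (ℓ : List ℕ) (h : t < T) :
    (List.range T ++ ℓ).getD t 0 = t := by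
  rw [List.getD_append _ _ _ _ (by simpa using h)]
  simp [List.getD_eq_getElem?_getD, h]

theorem getD_range_append_add (T : ℕ) (ℓ : List ℕ) (i : ℕ) :
    (List.range T ++ ℓ).getD (T + i) 0 = ℓ.getD i 0 := by
  rw [List.getD_append_right _ _ _ _ (by simp)]
  simp

theorem foldl_set_range (ℓ : List ℕ) (l r : List ℕ) (N : ℕ) (hℓ : N ≤ ℓ.length)
    (hr : N ≤ r.length) :
    ((List.range N).map fun j => (l.length + j, j)).foldl
      (fun s p => s.set p.1 (ℓ.getD p.2 0)) (l ++ r) = l ++ (ℓ.take N ++ r.drop N) := by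
  induction N with
  | zero => simp
  | succ N ih =>
    rw [List.range_succ, List.map_append, List.foldl_append, ih (by omega) (by omega)]
    have h : (ℓ.take N).length = N := by simp; omega
    simp only [List.map_cons, List.map_nil, List.foldl_cons, List.foldl_nil]
    rw [List.set_append_right _ _ (by omega), Nat.add_sub_cancel_left,
      List.set_append_right _ _ h.le, h, Nat.sub_self,
      List.drop_eq_getElem_cons (by omega : N < r.length), List.set_cons_zero,
      List.take_succ_eq_append_getElem (by omega : N < ℓ.length),
      List.getD_eq_getElem _ _ (by omega : N < ℓ.length), List.append_assoc, List.singleton_append]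

theorem Spec.run_load (S : Spec) {ℓ : List ℕ} (h : ℓ.length = S.arity) :
    ActionC.run ℓ S.load S.refuter.s0 = List.range S.numTags ++ ℓ := by
  have := foldl_set_range ℓ (List.range S.numTags) (List.replicate S.arity 0) S.arity h.ge (by simp)
  simp only [List.length_range] at this
  rw [ActionC.run, Spec.load, Spec.refuter, this, ← h]
  simp

/-- The word `w` labels a walk from `x` to a final state. -/
def ToplC.Accepts (A : ToplC) (x : ℕ × List ℕ) (w : List (List ℕ)) : Prop :=
  ∃ y, A.Reach x w y ∧ y.1 ∈ A.F

theorem ToplC.accepts_nil {A : ToplC} {x : ℕ × List ℕ} : A.Accepts x [] ↔ x.1 ∈ A.F := by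
  constructor
  · rintro ⟨y, ⟨⟩, h⟩
    exact h
  · exact fun h => ⟨x, .nil x, h⟩

theorem ToplC.accepts_cons {A : ToplC} {x : ℕ × List ℕ} {ℓ : List ℕ} {w : List (List ℕ)} :
    A.Accepts x (ℓ :: w) ↔ ∃ y, A.Step x ℓ y ∧ A.Accepts y w := by
  constructor
  · rintro ⟨z, h, hz⟩
    cases h with
    | cons hs hr => exact ⟨_, hs, z, hr, hz⟩
  · rintro ⟨y, hs, z, hr, hz⟩
    exact ⟨z, .cons hs hr, hz⟩

namespace Spec

theorem mem_delta (S : Spec) (t : ℕ × (GuardC × ActionC) × ℕ) :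
    t ∈ S.refuter.delta ↔ t = (0, ([], []), 0) ∨ t = (1, ([], []), 1) ∨
      (∃ q ∈ S.reqs, t = (0, ([(true, q.1, 0)], S.load), reqState q) ∨
        ∃ g ∈ S.mismatches q, t = (reqState q, (g, []), reqState q)) ∨
      ∃ c ∈ S.conflicts, t = (0, ([(true, c.1, 0)], S.load), conflictState c) ∨
        t = (conflictState c, ([], []), conflictState c) ∨ t = (conflictState c, (c.2, []), 1) := by
  simp [refuter, eq_comm]

theorem mismatches_wf {S : Spec} (hS : S.WF) {q : Requirement} (hq : q ∈ S.reqs) {g : GuardC}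
    (hg : g ∈ S.mismatches q) : ∀ p ∈ g, p.2.1 < S.numTags + S.arity ∧ p.2.2 < S.arity := by
  intro p hp
  obtain ⟨l, hl, hpl⟩ : ∃ l ∈ q.2.map S.mismatch, p ∈ l := by
    have := List.mem_sections.1 hg
    clear hg
    generalize q.2.map S.mismatch = L at this ⊢
    induction this with
    | nil => simp at hp
    | cons h _ ih =>
      rcases List.mem_cons.1 hp with rfl | hp
      · exact ⟨_, List.mem_cons_self, h⟩
      · obtain ⟨l, hl, h⟩ := ih hp
        exact ⟨l, List.mem_cons_of_mem _ hl, h⟩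
  obtain ⟨r, hr, rfl⟩ := List.mem_map.1 hl
  obtain ⟨hr, he⟩ := (hS.2.1 q hq).2 r hr
  have := hS.1
  rcases List.mem_cons.1 hpl with rfl | hpl
  · exact ⟨by simp only; omega, this⟩
  · obtain ⟨e, hmem, rfl⟩ := List.mem_map.1 hpl
    have := he e hmem
    exact ⟨by simp only; omega, this.2⟩

theorem refuter_wf {S : Spec} (hS : S.WF) : S.refuter.WF := by
  have hq : ∀ q ∈ S.reqs, reqState q < S.refuter.k := fun q hq => by
    have := List.le_sum_of_mem (List.mem_map_of_mem (f := reqState) hq)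
    simp only [refuter]
    omega
  have hc : ∀ c ∈ S.conflicts, conflictState c < S.refuter.k := fun c hc => by
    have := List.le_sum_of_mem (List.mem_map_of_mem (f := conflictState) hc)
    simp only [refuter]
    omega
  have h1 : 1 < S.refuter.k := by simp only [refuter]; omega
  have h0 : 0 < S.refuter.k := by omega
  have hload : ∀ p ∈ S.load, p.1 < S.refuter.m ∧ p.2 < S.refuter.n := by
    simp [load, refuter]
  have ht : ∀ t < S.numTags, ∀ p ∈ ([(true, t, 0)] : GuardC),
      p.2.1 < S.refuter.m ∧ p.2.2 < S.refuter.n := by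
    intro t ht p hp
    obtain rfl := List.mem_singleton.1 hp
    exact ⟨by simp only [refuter]; omega, hS.1⟩
  refine ⟨h0, by simp [refuter], ?_, ?_⟩
  · intro q hqF
    rcases List.mem_cons.1 hqF with rfl | hqF
    · exact h1
    · obtain ⟨q, hmem, rfl⟩ := List.mem_map.1 hqF
      exact hq q hmem
  · intro t hmem
    rcases (S.mem_delta t).1 hmem with rfl | rfl | ⟨q, hqS, rfl | ⟨g, hg, rfl⟩⟩ |
      ⟨c, hcS, rfl | rfl | rfl⟩
    · exact ⟨h0, h0, by simp, by simp⟩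
    · exact ⟨h1, h1, by simp, by simp⟩
    · exact ⟨h0, hq q hqS, ht _ (hS.2.1 q hqS).1, hload⟩
    · exact ⟨hq q hqS, hq q hqS, mismatches_wf hS hqS hg, by simp⟩
    · exact ⟨h0, hc c hcS, ht _ (hS.2.2 c hcS).1, hload⟩
    · exact ⟨hc c hcS, hc c hcS, by simp, by simp⟩
    · exact ⟨hc c hcS, h1, (hS.2.2 c hcS).2, by simp⟩

theorem step_one (S : Spec) (s ℓ : List ℕ) (y : ℕ × List ℕ) :
    S.refuter.Step (1, s) ℓ y ↔ y = (1, s) := by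
  obtain ⟨y, s'⟩ := y
  simp only [ToplC.Step, mem_delta, reqState, conflictState, Prod.mk.injEq]
  constructor
  · rintro ⟨g, a, h | h | ⟨q, hq, h | ⟨g, hg, h⟩⟩ | ⟨c, hc, h | h | h⟩, hs, hr⟩ <;> try omega
    obtain ⟨-, ⟨rfl, rfl⟩, rfl⟩ := h
    exact ⟨rfl, hr.symm⟩
  · rintro ⟨rfl, rfl⟩
    exact ⟨[], [], by simp, by simp [GuardC.Sat], rfl⟩

theorem step_reqState (S : Spec) {q : Requirement} (hq : q ∈ S.reqs) (s ℓ : List ℕ)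
    (y : ℕ × List ℕ) : S.refuter.Step (reqState q, s) ℓ y ↔
      y = (reqState q, s) ∧ ∃ g ∈ S.mismatches q, GuardC.Sat s ℓ g := by
  obtain ⟨y, s'⟩ := y
  simp only [ToplC.Step, mem_delta, reqState, conflictState, Prod.mk.injEq]
  constructor
  · rintro ⟨g, a, h | h | ⟨q', hq, h | ⟨g, hg, h⟩⟩ | ⟨c, hc, h | h | h⟩, hs, hr⟩ <;> try omega
    obtain ⟨h, ⟨rfl, rfl⟩, rfl⟩ := h
    obtain rfl : q = q' := Encodable.encode_injective (by omega)
    exact ⟨⟨rfl, hr.symm⟩, g, hg, hs⟩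
  · rintro ⟨⟨rfl, rfl⟩, g, hg, hs⟩
    exact ⟨g, [], .inr (.inr (.inl ⟨q, hq, .inr ⟨g, hg, rfl, ⟨rfl, rfl⟩, rfl⟩⟩)), hs, rfl⟩

theorem step_conflictState (S : Spec) {c : ℕ × GuardC} (hc : c ∈ S.conflicts) (s ℓ : List ℕ)
    (y : ℕ × List ℕ) : S.refuter.Step (conflictState c, s) ℓ y ↔
      y = (conflictState c, s) ∨ y = (1, s) ∧ GuardC.Sat s ℓ c.2 := by
  obtain ⟨y, s'⟩ := y
  simp only [ToplC.Step, mem_delta, reqState, conflictState, Prod.mk.injEq]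
  constructor
  · rintro ⟨g, a, h | h | ⟨q, hq, h | ⟨g, hg, h⟩⟩ | ⟨c', hc, h | h | h⟩, hs, hr⟩ <;> try omega
    · obtain ⟨h, ⟨rfl, rfl⟩, rfl⟩ := h
      exact .inl ⟨h.symm, hr.symm⟩
    · obtain ⟨h, ⟨rfl, rfl⟩, rfl⟩ := h
      obtain rfl : c = c' := Encodable.encode_injective (by omega)
      exact .inr ⟨⟨rfl, hr.symm⟩, hs⟩
  · rintro (⟨rfl, rfl⟩ | ⟨⟨rfl, rfl⟩, hs⟩)
    · exact ⟨[], [], .inr (.inr (.inr ⟨c, hc, .inr (.inl ⟨rfl, ⟨rfl, rfl⟩, rfl⟩)⟩)),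
        by simp [GuardC.Sat], rfl⟩
    · exact ⟨c.2, [], .inr (.inr (.inr ⟨c, hc, .inr (.inr ⟨rfl, ⟨rfl, rfl⟩, rfl⟩)⟩)), hs, rfl⟩

theorem step_zero {S : Spec} (hS : S.WF) {ℓ : List ℕ} (hℓ : ℓ.length = S.arity)
    (y : ℕ × List ℕ) : S.refuter.Step (0, S.refuter.s0) ℓ y ↔
      y = (0, S.refuter.s0) ∨
      (∃ q ∈ S.reqs, ℓ.getD 0 0 = q.1 ∧ y = (reqState q, List.range S.numTags ++ ℓ)) ∨
      ∃ c ∈ S.conflicts, ℓ.getD 0 0 = c.1 ∧ y = (conflictState c, List.range S.numTags ++ ℓ) := by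
  have hsat : ∀ t < S.numTags,
      (GuardC.Sat S.refuter.s0 ℓ [(true, t, 0)] ↔ ℓ.getD 0 0 = t) := by
    intro t ht
    simp only [GuardC.Sat, refuter, List.mem_singleton, forall_eq, getD_range_append_of_lt _ ht]
    simp [eq_comm]
  obtain ⟨y, s'⟩ := y
  simp only [ToplC.Step, mem_delta, reqState, conflictState, Prod.mk.injEq]
  constructor
  · rintro ⟨g, a, h | h | ⟨q, hq, h | ⟨g, hg, h⟩⟩ | ⟨c, hc, h | h | h⟩, hs, hr⟩ <;> try omega
    · obtain ⟨-, ⟨rfl, rfl⟩, rfl⟩ := h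
      exact .inl ⟨rfl, hr.symm⟩
    · obtain ⟨-, ⟨rfl, rfl⟩, rfl⟩ := h
      rw [run_load S hℓ] at hr
      exact .inr (.inl ⟨q, hq, (hsat _ (hS.2.1 q hq).1).1 hs, rfl, hr.symm⟩)
    · obtain ⟨-, ⟨rfl, rfl⟩, rfl⟩ := h
      rw [run_load S hℓ] at hr
      exact .inr (.inr ⟨c, hc, (hsat _ (hS.2.2 c hc).1).1 hs, rfl, hr.symm⟩)
  · rintro (⟨rfl, rfl⟩ | ⟨q, hq, hs, rfl, rfl⟩ | ⟨c, hc, hs, rfl, rfl⟩)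
    · exact ⟨[], [], .inl ⟨trivial, ⟨rfl, rfl⟩, rfl⟩, by simp [GuardC.Sat], rfl⟩
    · exact ⟨_, _, .inr (.inr (.inl ⟨q, hq, .inl ⟨trivial, ⟨rfl, rfl⟩, rfl⟩⟩)),
        (hsat _ (hS.2.1 q hq).1).2 hs, run_load S hℓ⟩
    · exact ⟨_, _, .inr (.inr (.inr ⟨c, hc, .inl ⟨trivial, ⟨rfl, rfl⟩, rfl⟩⟩)),
        (hsat _ (hS.2.2 c hc).1).2 hs, run_load S hℓ⟩

theorem accepts_one (S : Spec) (s : List ℕ) (w : List (List ℕ)) : S.refuter.Accepts (1, s) w := by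
  induction w with
  | nil => exact ToplC.accepts_nil.2 List.mem_cons_self
  | cons ℓ w ih => exact ToplC.accepts_cons.2 ⟨_, (step_one S s ℓ _).2 rfl, ih⟩

theorem accepts_conflictState (S : Spec) {c : ℕ × GuardC} (hc : c ∈ S.conflicts) (s : List ℕ)
    (w : List (List ℕ)) :
    S.refuter.Accepts (conflictState c, s) w ↔ ∃ ℓ ∈ w, GuardC.Sat s ℓ c.2 := by
  induction w with
  | nil =>
    simp only [ToplC.accepts_nil, refuter, List.mem_cons, List.mem_map, reqState, conflictState,
      List.not_mem_nil, false_and, exists_false, iff_false]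
    rintro (h | ⟨q, -, h⟩) <;> omega
  | cons ℓ w ih =>
    simp [ToplC.accepts_cons, step_conflictState S hc, or_and_right, exists_or, ih, accepts_one,
      or_comm]

theorem accepts_reqState (S : Spec) {q : Requirement} (hq : q ∈ S.reqs) (s : List ℕ)
    (w : List (List ℕ)) : S.refuter.Accepts (reqState q, s) w ↔
      ∀ ℓ ∈ w, ∃ g ∈ S.mismatches q, GuardC.Sat s ℓ g := by
  induction w with
  | nil =>
    simp only [ToplC.accepts_nil, refuter, List.not_mem_nil, false_imp_iff, implies_true, iff_true]
    exact List.mem_cons_of_mem _ (List.mem_map_of_mem hq)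
  | cons ℓ w ih =>
    simp [ToplC.accepts_cons, step_reqState S hq, ih, and_assoc]

theorem exists_sections_sat (s ℓ : List ℕ) (L : List GuardC) :
    (∃ g ∈ L.sections, GuardC.Sat s ℓ g) ↔ ∀ l ∈ L, ∃ p ∈ l, GuardC.Sat s ℓ [p] := by
  induction L with
  | nil => simp [GuardC.Sat]
  | cons l L ih =>
    rw [List.forall_mem_cons, ← ih]
    constructor
    · rintro ⟨g, hg, hs⟩
      cases List.mem_sections.1 hg with
      | @cons p _ g _ hp hg =>
        exact ⟨⟨p, hp, fun r hr => hs r (List.mem_singleton.1 hr ▸ List.mem_cons_self)⟩,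
          g, List.mem_sections.2 hg, fun r hr => hs r (List.mem_cons_of_mem _ hr)⟩
    · rintro ⟨⟨p, hp, hsp⟩, g, hg, hs⟩
      refine ⟨p :: g, List.mem_sections.2 (.cons hp (List.mem_sections.1 hg)), fun r hr => ?_⟩
      rcases List.mem_cons.1 hr with rfl | hr
      exacts [hsp _ (List.mem_singleton_self _), hs r hr]

theorem exists_mismatches_sat {S : Spec} (hS : S.WF) {q : Requirement} (hq : q ∈ S.reqs)
    (ℓ ℓ' : List ℕ) :
    (∃ g ∈ S.mismatches q, GuardC.Sat (List.range S.numTags ++ ℓ) ℓ' g) ↔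
      ∀ p ∈ q.2, ¬ Matches p ℓ ℓ' := by
  rw [mismatches, exists_sections_sat, List.forall_mem_map]
  refine forall₂_congr fun p hp => ?_
  have ht := ((hS.2.1 q hq).2 p hp).1
  simp only [mismatch, List.mem_cons, List.mem_map, exists_eq_or_imp, exists_exists_and_eq_and,
    GuardC.Sat, List.not_mem_nil, or_false, forall_eq, getD_range_append_of_lt _ ht,
    getD_range_append_add, Matches]
  simp only [not_and_or, not_forall, Bool.false_eq_true, false_imp_iff, true_and, forall_const,
    exists_prop, ne_eq, eq_comm (a := p.1)]

theorem accepts_refuter {S : Spec} (hS : S.WF) {w : List (List ℕ)}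
    (hw : ∀ ℓ ∈ w, ℓ.length = S.arity) :
    S.refuter.Accepts (0, S.refuter.s0) w ↔ ¬ S.Satisfied w := by
  induction w with
  | nil =>
    simp [ToplC.accepts_nil, refuter, Satisfied, reqState]
  | cons ℓ w ih =>
    rw [List.forall_mem_cons] at hw
    rw [ToplC.accepts_cons, Satisfied, not_and_or, not_and_or, ← ih hw.2]
    simp only [step_zero hS hw.1]
    constructor
    · rintro ⟨y, rfl | ⟨q, hq, hs, rfl⟩ | ⟨c, hc, hs, rfl⟩, h⟩
      · exact .inr (.inr h)
      · rw [accepts_reqState S hq] at h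
        refine .inl fun h' => ?_
        obtain ⟨ℓ', hℓ', p, hp, hm⟩ := h' q hq hs
        exact (exists_mismatches_sat hS hq ℓ ℓ').1 (h ℓ' hℓ') p hp hm
      · obtain ⟨ℓ', hℓ', hsat⟩ := (accepts_conflictState S hc _ _).1 h
        exact .inr (.inl fun h' => h' c hc hs ℓ' hℓ' hsat)
    · rintro (h | h | h)
      · push Not at h
        obtain ⟨q, hq, hs, h⟩ := h
        exact ⟨_, .inr (.inl ⟨q, hq, hs, rfl⟩), (accepts_reqState S hq _ _).2 fun ℓ' hℓ' =>
          (exists_mismatches_sat hS hq ℓ ℓ').2 (h ℓ' hℓ')⟩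
      · push Not at h
        obtain ⟨c, hc, hs, h⟩ := h
        exact ⟨_, .inr (.inr ⟨c, hc, hs, rfl⟩), (accepts_conflictState S hc _ _).2 h⟩
      · exact ⟨_, .inl rfl, h⟩

theorem mem_lang_refuter {S : Spec} (hS : S.WF) {w : List (List ℕ)}
    (hw : ∀ ℓ ∈ w, ℓ.length = S.arity) : w ∈ S.refuter.Lang ↔ ¬ S.Satisfied w :=
  (and_iff_right hw).trans (accepts_refuter hS hw)

end Spec

/-! ### Words recording derivations -/

/-- The value of a variable in a letter. -/
def val (ℓ : List ℕ) (v : ℕ) : ℕ := ℓ.getD (v + 1) 0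

/-- The given rules preceded by clauses standing for the graphs of zero and successor. The tag of
a letter is the index of the clause it instantiates. -/
def allRules (R : List Rule) : List Rule := ⟨zeroRel, [0], []⟩ :: ⟨succRel, [0, 1], []⟩ :: R

open Classical in
/-- The patterns of the letters asserting an instance of the atom `b`. -/
noncomputable def targets (R : List Rule) (b : Set (List ℕ) × List ℕ) :
    List (ℕ × List (ℕ × ℕ)) :=
  ((allRules R).zipIdx.filter fun p => p.1.rel = b.1 ∧ p.1.args.length = b.2.length).map
    fun p => (p.2, b.2.zip p.1.args)

/-- Every letter is an instance of a rule whose premises are asserted later; the letters tagged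
`0` and `1` give every number at most one predecessor. -/
noncomputable def ruleSpec (R : List Rule) (K : ℕ) : Spec where
  numTags := R.length + 2
  arity := K + 1
  reqs := (1, [(0, [(1, 0)]), (1, [(1, 0)])]) ::
    (allRules R).zipIdx.flatMap fun p => p.1.body.map fun b => (p.2, targets R b)
  conflicts := [(0, [(true, 1, 0), (true, R.length + 2 + 1, 1)]),
    (1, [(true, 0, 0), (true, R.length + 2 + 1, 1)]),
    (1, [(true, 1, 0), (true, R.length + 2 + 1, 1), (false, R.length + 2 + 2, 2)])]

/-- Some letter of `w` is an instance of a rule with conclusion `P xs`. -/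
def Asserts (R : List Rule) (w : List (List ℕ)) (P : Set (List ℕ)) (xs : List ℕ) : Prop :=
  ∃ ℓ ∈ w, ∃ r, (allRules R)[ℓ.getD 0 0]? = some r ∧ r.rel = P ∧ r.args.map (val ℓ) = xs

/-- All variables occurring in `R` are smaller than `K`. -/
def VarsBelow (R : List Rule) (K : ℕ) : Prop :=
  ∀ r ∈ R, (∀ v ∈ r.args, v < K) ∧ ∀ b ∈ r.body, ∀ v ∈ b.2, v < K

theorem exists_varsBelow (R : List Rule) : ∃ K, 2 ≤ K ∧ VarsBelow R K := by
  let L := R.flatMap fun r => r.args ++ r.body.flatMap fun b => b.2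
  have hL : ∀ v ∈ L, v < L.sum + 2 := fun v hv => by
    have := List.le_sum_of_mem hv
    omega
  refine ⟨L.sum + 2, by omega, fun r hr => ⟨fun v hv => hL v ?_, fun b hb v hv => hL v ?_⟩⟩
  · exact List.mem_flatMap.2 ⟨r, hr, List.mem_append_left _ hv⟩
  · exact List.mem_flatMap.2 ⟨r, hr, List.mem_append_right _ (List.mem_flatMap.2 ⟨b, hb, hv⟩)⟩

theorem VarsBelow.allRules {R : List Rule} {K : ℕ} (h : VarsBelow R K) (hK : 2 ≤ K) :
    VarsBelow (allRules R) K := by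
  intro r hr
  simp only [Topl.allRules, List.mem_cons] at hr
  rcases hr with rfl | rfl | hr
  · simp; omega
  · simp; omega
  · exact h r hr

theorem ruleSpec_wf {R : List Rule} {K : ℕ} (h : VarsBelow R K) (hK : 2 ≤ K) :
    (ruleSpec R K).WF := by
  refine ⟨Nat.succ_pos _, ?_, ?_⟩
  · intro q hq
    rcases List.mem_cons.1 hq with rfl | hq
    · simp [ruleSpec]; omega
    · obtain ⟨⟨r, i⟩, hi, hq⟩ := List.mem_flatMap.1 hq
      obtain ⟨b, hb, rfl⟩ := List.mem_map.1 hq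
      have hlen : ∀ {r : Rule} {i : ℕ}, (r, i) ∈ (allRules R).zipIdx → i < R.length + 2 := by
        intro r i hi
        rw [List.mk_mem_zipIdx_iff_getElem?] at hi
        exact (List.getElem?_eq_some_iff.1 hi).1
      have hr : r ∈ allRules R := List.mem_of_getElem? (List.mk_mem_zipIdx_iff_getElem?.1 hi)
      refine ⟨hlen hi, fun p hp => ?_⟩
      obtain ⟨⟨r', j⟩, hj, rfl⟩ := List.mem_map.1 hp
      have hj := (List.mem_filter.1 hj).1
      have hr' : r' ∈ allRules R := List.mem_of_getElem? (List.mk_mem_zipIdx_iff_getElem?.1 hj)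
      refine ⟨hlen hj, fun e he => ?_⟩
      obtain ⟨h1, h2⟩ := List.of_mem_zip he
      exact ⟨Nat.succ_lt_succ ((h.allRules hK r hr).2 b hb _ h1),
        Nat.succ_lt_succ ((h.allRules hK r' hr').1 _ h2)⟩
  · simp only [ruleSpec, List.forall_mem_cons, List.not_mem_nil, false_imp_iff, implies_true,
      and_true]
    omega

theorem forall_mem_zip_iff_map_eq (f g : ℕ → ℕ) {as bs : List ℕ} (h : bs.length = as.length) :
    (∀ e ∈ as.zip bs, f e.1 = g e.2) ↔ bs.map g = as.map f := by
  induction as generalizing bs with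
  | nil => simp [List.length_eq_zero_iff.1 h]
  | cons a as ih =>
    cases bs with
    | nil => simp at h
    | cons b bs =>
      rw [List.zip_cons_cons, List.forall_mem_cons, ih (Nat.succ.inj h), List.map_cons,
        List.map_cons, List.cons.injEq, eq_comm]

theorem exists_matches_targets (R : List Rule) (b : Set (List ℕ) × List ℕ) (ℓ : List ℕ)
    (w : List (List ℕ)) : (∃ ℓ' ∈ w, ∃ p ∈ targets R b, Matches p ℓ ℓ') ↔
      Asserts R w b.1 (b.2.map (val ℓ)) := by
  refine exists_congr fun ℓ' => and_congr_right fun _ => ?_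
  constructor
  · rintro ⟨p, hp, ht, hm⟩
    obtain ⟨⟨r, j⟩, hj, rfl⟩ := List.mem_map.1 hp
    obtain ⟨hj, hb⟩ := List.mem_filter.1 hj
    obtain ⟨hrel, hlen⟩ := of_decide_eq_true hb
    refine ⟨r, ?_, hrel, (forall_mem_zip_iff_map_eq _ _ hlen).1 hm⟩
    rw [ht]
    exact List.mk_mem_zipIdx_iff_getElem?.1 hj
  · rintro ⟨r, hr, hrel, hargs⟩
    have hlen : r.args.length = b.2.length := by simpa using congrArg List.length hargs
    refine ⟨_, List.mem_map_of_mem (List.mem_filter.2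
      ⟨List.mk_mem_zipIdx_iff_getElem?.2 hr, decide_eq_true ⟨hrel, hlen⟩⟩), rfl, ?_⟩
    exact (forall_mem_zip_iff_map_eq _ _ hlen).2 hargs

/-- The letter `ℓ` says something about the number represented by `x`. -/
def Describes (ℓ : List ℕ) (x : ℕ) : Prop :=
  (ℓ.getD 0 0 = 0 ∨ ℓ.getD 0 0 = 1) ∧ val ℓ 0 = x

theorem satisfied_cons {R : List Rule} {K : ℕ} {ℓ : List ℕ} {w : List (List ℕ)} :
    (ruleSpec R K).Satisfied (ℓ :: w) ↔
      ((ℓ.getD 0 0 = 1 → ∃ ℓ' ∈ w, Describes ℓ' (val ℓ 1)) ∧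
        ∀ r, (allRules R)[ℓ.getD 0 0]? = some r →
          ∀ b ∈ r.body, Asserts R w b.1 (b.2.map (val ℓ))) ∧
      (∀ ℓ' ∈ w, Describes ℓ (val ℓ' 0) → Describes ℓ' (val ℓ 0) →
        ℓ.getD 0 0 = ℓ'.getD 0 0 ∧ (ℓ.getD 0 0 = 1 → val ℓ 1 = val ℓ' 1)) ∧
      (ruleSpec R K).Satisfied w := by
  rw [Spec.Satisfied]
  refine and_congr ?_ (and_congr_left fun _ => ?_)
  · have : (ruleSpec R K).reqs = (1, [(0, [(1, 0)]), (1, [(1, 0)])]) ::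
      (allRules R).zipIdx.flatMap fun p => p.1.body.map fun b => (p.2, targets R b) := rfl
    rw [this, List.forall_mem_cons]
    refine and_congr ?_ ?_
    · refine imp_congr_right fun _ => exists_congr fun ℓ' => and_congr_right fun _ => ?_
      simp only [List.mem_cons, List.not_mem_nil, or_false, exists_eq_or_imp, exists_eq_left,
        forall_eq, Matches, Describes, val]
      grind
    · constructor
      · intro h r hr b hb
        rw [← exists_matches_targets]
        exact h (_, targets R b) (List.mem_flatMap.2 ⟨(r, _),
          List.mk_mem_zipIdx_iff_getElem?.2 hr, List.mem_map_of_mem hb⟩) rfl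
      · intro h q hq ht
        obtain ⟨⟨r, i⟩, hi, hq⟩ := List.mem_flatMap.1 hq
        obtain ⟨b, hb, rfl⟩ := List.mem_map.1 hq
        rw [exists_matches_targets]
        refine h r ?_ b hb
        rw [ht]
        exact List.mk_mem_zipIdx_iff_getElem?.1 hi
  · have h0 : (List.range (R.length + 2) ++ ℓ).getD 0 0 = 0 := getD_range_append_of_lt ℓ (by omega)
    have h1 : (List.range (R.length + 2) ++ ℓ).getD 1 0 = 1 := getD_range_append_of_lt ℓ (by omega)
    have h2 := getD_range_append_add (R.length + 2) ℓ
    have hc : (ruleSpec R K).conflicts = [(0, [(true, 1, 0), (true, R.length + 2 + 1, 1)]),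
      (1, [(true, 0, 0), (true, R.length + 2 + 1, 1)]),
      (1, [(true, 1, 0), (true, R.length + 2 + 1, 1), (false, R.length + 2 + 2, 2)])] := rfl
    have hn : (ruleSpec R K).numTags = R.length + 2 := rfl
    simp only [hc, hn, GuardC.Sat, List.forall_mem_cons, List.not_mem_nil, false_imp_iff,
      implies_true, and_true, h0, h1, h2, Describes, val]
    constructor
    · intro h ℓ' hℓ'
      have := h.1
      have := h.2.1
      have := h.2.2
      grind
    · intro h
      refine ⟨?_, ?_, ?_⟩ <;> intro ht ℓ' hℓ' <;> have := h ℓ' hℓ' <;> grind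

theorem exists_describes {R : List Rule} {K : ℕ} {w : List (List ℕ)}
    (hw : (ruleSpec R K).Satisfied w) : ∀ ℓ ∈ w, ℓ.getD 0 0 = 1 →
      ∃ ℓ' ∈ w, Describes ℓ' (val ℓ 1) := by
  induction w with
  | nil => simp
  | cons ℓ w ih =>
    obtain ⟨⟨h, -⟩, -, hw⟩ := satisfied_cons.1 hw
    intro ℓ' hℓ' ht
    obtain ⟨ℓ₂, h₂, hd⟩ : ∃ ℓ₂ ∈ w, Describes ℓ₂ (val ℓ' 1) := by
      rcases List.mem_cons.1 hℓ' with rfl | hℓ'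
      exacts [h ht, ih hw ℓ' hℓ' ht]
    exact ⟨ℓ₂, List.mem_cons_of_mem _ h₂, hd⟩

/-- What a letter says about zero and successor holds when numbers are read through `φ`. -/
def NumSound (φ : ℕ → ℕ) (ℓ : List ℕ) : Prop :=
  (ℓ.getD 0 0 = 0 → φ (val ℓ 0) = 0) ∧ (ℓ.getD 0 0 = 1 → φ (val ℓ 0) = φ (val ℓ 1) + 1)

theorem exists_numSound {R : List Rule} {K : ℕ} {w : List (List ℕ)}
    (hw : (ruleSpec R K).Satisfied w) : ∃ φ : ℕ → ℕ, ∀ ℓ ∈ w, NumSound φ ℓ := by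
  induction w with
  | nil => exact ⟨id, by simp⟩
  | cons ℓ w ih =>
    obtain ⟨⟨hreq, -⟩, hcon, hw⟩ := satisfied_cons.1 hw
    obtain ⟨φ, hφ⟩ := ih hw
    by_cases hd : ∃ ℓ' ∈ w, Describes ℓ' (val ℓ 0)
    · obtain ⟨ℓ', hℓ', hd⟩ := hd
      refine ⟨φ, List.forall_mem_cons.2 ⟨?_, hφ⟩⟩
      obtain ⟨h0, h1⟩ := hφ ℓ' hℓ'
      have := hcon ℓ' hℓ'
      constructor
      · intro ht
        obtain ⟨h, -⟩ := this ⟨.inl ht, hd.2.symm⟩ hd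
        rw [← hd.2, h0 (h ▸ ht)]
      · intro ht
        obtain ⟨h, h'⟩ := this ⟨.inr ht, hd.2.symm⟩ hd
        rw [← hd.2, h1 (h ▸ ht), h' ht]
    · push Not at hd
      have hne : ∀ ℓ', ℓ' = ℓ ∨ ℓ' ∈ w → ℓ'.getD 0 0 = 1 → val ℓ' 1 ≠ val ℓ 0 := by
        rintro ℓ' h ht heq
        obtain ⟨ℓ₂, h₂, hd₂⟩ : ∃ ℓ₂ ∈ w, Describes ℓ₂ (val ℓ' 1) := by
          rcases h with rfl | h
          exacts [hreq ht, exists_describes hw ℓ' h ht]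
        exact hd ℓ₂ h₂ (heq ▸ hd₂)
      refine ⟨Function.update φ (val ℓ 0) (if ℓ.getD 0 0 = 0 then 0 else φ (val ℓ 1) + 1),
        List.forall_mem_cons.2 ⟨⟨fun ht => ?_, fun ht => ?_⟩, fun ℓ' hℓ' =>
          ⟨fun ht => ?_, fun ht => ?_⟩⟩⟩
      · rw [Function.update_self, if_pos ht]
      · rw [Function.update_self, Function.update_of_ne (hne ℓ (.inl rfl) ht), if_neg (by omega)]
      · have : val ℓ' 0 ≠ val ℓ 0 := fun h => hd ℓ' hℓ' ⟨.inl ht, h⟩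
        rw [Function.update_of_ne this, (hφ ℓ' hℓ').1 ht]
      · have : val ℓ' 0 ≠ val ℓ 0 := fun h => hd ℓ' hℓ' ⟨.inr ht, h⟩
        rw [Function.update_of_ne this, Function.update_of_ne (hne ℓ' (.inr hℓ') ht),
          (hφ ℓ' hℓ').2 ht]

theorem mem_of_asserts {R : List Rule} {K : ℕ} (hR : ∀ r ∈ R, r.Sound) {φ : ℕ → ℕ}
    {w : List (List ℕ)} (hw : (ruleSpec R K).Satisfied w) (hφ : ∀ ℓ ∈ w, NumSound φ ℓ)
    {P : Set (List ℕ)} {xs : List ℕ} (h : Asserts R w P xs) : xs.map φ ∈ P := by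
  induction w generalizing P xs with
  | nil => simp [Asserts] at h
  | cons ℓ w ih =>
    obtain ⟨⟨-, hreq⟩, -, hw'⟩ := satisfied_cons.1 hw
    obtain ⟨hℓ, hφ'⟩ := List.forall_mem_cons.1 hφ
    obtain ⟨ℓ', hℓ', r, hr, rfl, rfl⟩ := h
    rcases List.mem_cons.1 hℓ' with rfl | hℓ'
    · rcases ht : ℓ'.getD 0 0 with _ | _ | i
      · rw [ht] at hr
        obtain rfl := Option.some.inj hr
        simp [zeroRel, hℓ.1 ht]
      · rw [ht] at hr
        obtain rfl := Option.some.inj hr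
        simp [succRel, hℓ.2 ht]
      · have hmem : r ∈ R := by
          rw [ht] at hr
          exact List.mem_of_getElem? (i := i) hr
        rw [List.map_map]
        refine hR r hmem _ fun b hb => ?_
        rw [← List.map_map]
        exact ih hw' hφ' (hreq r hr b hb)
    · exact ih hw' hφ' ⟨ℓ', hℓ', r, hr, rfl, rfl⟩

/-- The letter represents numbers by themselves. -/
def Truthful (K : ℕ) (ℓ : List ℕ) : Prop :=
  ℓ.length = K + 1 ∧ (ℓ.getD 0 0 = 0 → val ℓ 0 = 0) ∧ (ℓ.getD 0 0 = 1 → val ℓ 0 = val ℓ 1 + 1)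

/-- A word that satisfies the specification and represents numbers by themselves. -/
def Faithful (R : List Rule) (K : ℕ) (w : List (List ℕ)) : Prop :=
  (ruleSpec R K).Satisfied w ∧ ∀ ℓ ∈ w, Truthful K ℓ

theorem Asserts.mono {R : List Rule} {w w' : List (List ℕ)} (h : w ⊆ w') {P : Set (List ℕ)}
    {xs : List ℕ} : Asserts R w P xs → Asserts R w' P xs :=
  fun ⟨ℓ, hℓ, hr⟩ => ⟨ℓ, h hℓ, hr⟩

theorem Faithful.cons {R : List Rule} {K : ℕ} {ℓ : List ℕ} {w : List (List ℕ)}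
    (hw : Faithful R K w) (hℓ : Truthful K ℓ)
    (hnum : ℓ.getD 0 0 = 1 → ∃ ℓ' ∈ w, Describes ℓ' (val ℓ 1))
    (hreq : ∀ r, (allRules R)[ℓ.getD 0 0]? = some r →
      ∀ b ∈ r.body, Asserts R w b.1 (b.2.map (val ℓ))) : Faithful R K (ℓ :: w) := by
  refine ⟨satisfied_cons.2 ⟨⟨hnum, hreq⟩, fun ℓ' hℓ' h h' => ?_, hw.1⟩,
    List.forall_mem_cons.2 ⟨hℓ, hw.2⟩⟩
  obtain ⟨-, h0, h1⟩ := hℓ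
  obtain ⟨-, h0', h1'⟩ := hw.2 ℓ' hℓ'
  obtain ⟨ht, heq⟩ := h
  obtain ⟨ht', -⟩ := h'
  rcases ht with ht | ht <;> rcases ht' with ht' | ht'
  all_goals first
    | have := h0 ht
    | have := h1 ht
  all_goals first
    | have := h0' ht'
    | have := h1' ht'
  all_goals exact ⟨by omega, by omega⟩

theorem Faithful.append {R : List Rule} {K : ℕ} {w w' : List (List ℕ)} (hw : Faithful R K w)
    (hw' : Faithful R K w') : Faithful R K (w ++ w') := by
  induction w with
  | nil => exact hw'
  | cons ℓ w ih =>
    obtain ⟨hs, ht⟩ := hw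
    obtain ⟨hℓ, ht⟩ := List.forall_mem_cons.1 ht
    obtain ⟨⟨hnum, hreq⟩, -, hs⟩ := satisfied_cons.1 hs
    refine (ih ⟨hs, ht⟩).cons hℓ (fun h => ?_)
      fun r hr b hb => (hreq r hr b hb).mono (List.subset_append_left _ _)
    obtain ⟨ℓ', hℓ', hd⟩ := hnum h
    exact ⟨ℓ', List.mem_append_left _ hℓ', hd⟩

/-- The letter instantiating the clause number `t`. -/
def letter (K t : ℕ) (σ : ℕ → ℕ) : List ℕ := t :: (List.range K).map σ

theorem val_letter {K v : ℕ} (t : ℕ) (σ : ℕ → ℕ) (h : v < K) : val (letter K t σ) v = σ v := by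
  simp [val, letter, List.getD_eq_getElem?_getD, h]

theorem map_val_letter {K : ℕ} (t : ℕ) (σ : ℕ → ℕ) {l : List ℕ} (h : ∀ v ∈ l, v < K) :
    l.map (val (letter K t σ)) = l.map σ :=
  List.map_congr_left fun v hv => val_letter t σ (h v hv)

/-- The word generating the numbers `≤ n`. -/
def chain (K : ℕ) : ℕ → List (List ℕ)
  | 0 => [letter K 0 (assign [])]
  | n + 1 => letter K 1 (assign [n + 1, n]) :: chain K n

theorem faithful_chain (R : List Rule) {K : ℕ} (hK : 2 ≤ K) (n : ℕ) :
    Faithful R K (chain K n) ∧ ∃ w, ∃ ℓ, chain K n = ℓ :: w ∧ Describes ℓ n := by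
  have nil : Faithful R K [] := ⟨trivial, by simp⟩
  induction n with
  | zero =>
    have hv : val (letter K 0 (assign [])) 0 = 0 := val_letter _ _ (by omega)
    refine ⟨nil.cons ⟨by simp [letter], fun _ => hv, by simp [letter]⟩ (by simp [letter]) ?_,
      _, _, rfl, .inl rfl, hv⟩
    intro r hr
    obtain rfl := Option.some.inj hr
    simp
  | succ n ih =>
    obtain ⟨hf, w, ℓ, hw, hd⟩ := ih
    have hv : val (letter K 1 (assign [n + 1, n])) 0 = n + 1 := val_letter _ _ (by omega)
    have hv' : val (letter K 1 (assign [n + 1, n])) 1 = n := val_letter _ _ (by omega)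
    refine ⟨hf.cons ⟨by simp [letter], by simp [letter], fun _ => by rw [hv, hv']⟩
      (fun _ => ⟨ℓ, hw ▸ List.mem_cons_self, hv'.symm ▸ hd⟩) ?_, _, _, rfl, .inr rfl, hv⟩
    intro r hr
    obtain rfl := Option.some.inj hr
    simp

theorem exists_faithful_of_derives {R : List Rule} {K : ℕ} (h : VarsBelow R K) (hK : 2 ≤ K)
    {P : Set (List ℕ)} {xs : List ℕ} (hd : Derives R P xs) :
    ∃ w, Faithful R K w ∧ Asserts R w P xs := by
  induction hd with
  | zero =>
    refine ⟨_, (faithful_chain R hK 0).1, _, List.mem_cons_self, _, rfl, rfl, ?_⟩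
    exact map_val_letter _ _ (by simp; omega)
  | succ x =>
    refine ⟨_, (faithful_chain R hK (x + 1)).1, _, List.mem_cons_self, _, rfl, rfl, ?_⟩
    exact map_val_letter _ _ (by simp; omega)
  | rule r hr σ _ ih =>
    obtain ⟨hargs, hbody⟩ := h r hr
    have hall : ∀ bs : List (Set (List ℕ) × List ℕ), bs ⊆ r.body →
        ∃ w, Faithful R K w ∧ ∀ b ∈ bs, Asserts R w b.1 (b.2.map σ) := by
      intro bs
      induction bs with
      | nil => exact fun _ => ⟨[], ⟨trivial, by simp⟩, by simp⟩
      | cons b bs ih' =>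
        intro hbs
        obtain ⟨hb, hbs⟩ := List.cons_subset.1 hbs
        obtain ⟨w, hw, ha⟩ := ih' hbs
        obtain ⟨w', hw', ha'⟩ := ih b hb
        exact ⟨w' ++ w, hw'.append hw, List.forall_mem_cons.2
          ⟨ha'.mono (List.subset_append_left _ _),
            fun b hb => (ha b hb).mono (List.subset_append_right _ _)⟩⟩
    obtain ⟨w, hw, ha⟩ := hall r.body (List.Subset.refl _)
    obtain ⟨i, hi⟩ := List.mem_iff_getElem?.1 hr
    refine ⟨letter K (i + 2) σ :: w, hw.cons ⟨by simp [letter], by simp [letter], by simp [letter]⟩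
      (by simp [letter]) ?_, _, List.mem_cons_self, r, hi, rfl, map_val_letter _ _ hargs⟩
    intro r' hr' b hb
    obtain rfl := Option.some.inj (hi.symm.trans hr')
    rw [map_val_letter _ _ (hbody b hb)]
    exact ha b hb

/-! ### Automata prescribing the beginning of a word -/

/-- The automaton accepting the words that start with a letter tagged `2`, whose first variable is
the head of a chain of `n` letters tagged `1` ending in a letter tagged `0`. -/
def chainAut (N n : ℕ) : ToplC where
  m := 4
  n := N
  k := n + 3
  q0 := 0
  s0 := [0, 1, 2, 0]
  delta := (0, ([(true, 2, 0)], [(3, 1)]), 1) ::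
    (n + 1, ([(true, 0, 0), (true, 3, 1)], []), n + 2) :: (n + 2, ([], []), n + 2) ::
    (List.range n).map fun i => (i + 1, ([(true, 1, 0), (true, 3, 1)], [(3, 2)]), i + 2)
  F := [n + 2]

theorem chainAut_wf {N : ℕ} (n : ℕ) (hN : 3 ≤ N) : (chainAut N n).WF := by
  refine ⟨Nat.succ_pos _, rfl, by simp [chainAut], fun t ht => ?_⟩
  simp only [chainAut, List.mem_cons, List.mem_map, List.mem_range] at ht ⊢
  rcases ht with rfl | rfl | rfl | ⟨i, hi, rfl⟩ <;> simp <;> omega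

theorem chainAut_step_zero {N n : ℕ} {ℓ : List ℕ} {y : ℕ × List ℕ} :
    (chainAut N n).Step (0, [0, 1, 2, 0]) ℓ y ↔ ℓ.getD 0 0 = 2 ∧ y = (1, [0, 1, 2, val ℓ 0]) := by
  obtain ⟨q, s⟩ := y
  constructor
  · rintro ⟨g, a, hd, hg, ha⟩
    simp only [chainAut, List.mem_cons, List.mem_map, List.mem_range, Prod.mk.injEq] at hd
    rcases hd with ⟨-, ⟨rfl, rfl⟩, rfl⟩ | ⟨h, -⟩ | ⟨h, -⟩ | ⟨i, -, h, -⟩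
    · have := (hg _ List.mem_cons_self).1 rfl
      exact ⟨this.symm, Prod.ext rfl ha.symm⟩
    all_goals omega
  · rintro ⟨ht, h⟩
    obtain ⟨rfl, rfl⟩ := Prod.mk.inj h
    refine ⟨_, _, List.mem_cons_self, ?_, rfl⟩
    simp only [GuardC.Sat, List.mem_singleton, forall_eq]
    exact ⟨fun _ => ht.symm, by simp⟩

theorem chainAut_step_succ {N n i v : ℕ} (hi : i ≤ n) {ℓ : List ℕ} {y : ℕ × List ℕ} :
    (chainAut N n).Step (i + 1, [0, 1, 2, v]) ℓ y ↔ v = val ℓ 0 ∧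
      (i < n ∧ ℓ.getD 0 0 = 1 ∧ y = (i + 2, [0, 1, 2, val ℓ 1]) ∨
        i = n ∧ ℓ.getD 0 0 = 0 ∧ y = (n + 2, [0, 1, 2, v])) := by
  obtain ⟨q, s⟩ := y
  constructor
  · rintro ⟨g, a, hd, hg, ha⟩
    simp only [chainAut, List.mem_cons, List.mem_map, List.mem_range, Prod.mk.injEq] at hd
    rcases hd with ⟨h, -⟩ | ⟨h, ⟨rfl, rfl⟩, rfl⟩ | ⟨h, -⟩ | ⟨j, hj, h, ⟨rfl, rfl⟩, rfl⟩
    · omega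
    · have h0 := (hg _ List.mem_cons_self).1 rfl
      have h1 := (hg _ (List.mem_cons_of_mem _ List.mem_cons_self)).1 rfl
      exact ⟨h1, .inr ⟨by omega, h0.symm, Prod.ext rfl ha.symm⟩⟩
    · omega
    · have h0 := (hg _ List.mem_cons_self).1 rfl
      have h1 := (hg _ (List.mem_cons_of_mem _ List.mem_cons_self)).1 rfl
      obtain rfl : j = i := by omega
      exact ⟨h1, .inl ⟨hj, h0.symm, Prod.ext rfl ha.symm⟩⟩
  · rintro ⟨hv, ⟨hi, ht, h⟩ | ⟨rfl, ht, h⟩⟩ <;> obtain ⟨rfl, rfl⟩ := Prod.mk.inj h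
    · refine ⟨[(true, 1, 0), (true, 3, 1)], [(3, 2)], ?_, ?_, rfl⟩
      · simp [chainAut, hi]
      · simp only [GuardC.Sat, List.forall_mem_cons]
        exact ⟨⟨fun _ => ht.symm, by simp⟩, ⟨fun _ => hv, by simp⟩, by simp⟩
    · refine ⟨[(true, 0, 0), (true, 3, 1)], [], ?_, ?_, rfl⟩
      · simp [chainAut]
      · simp only [GuardC.Sat, List.forall_mem_cons]
        exact ⟨⟨fun _ => ht.symm, by simp⟩, ⟨fun _ => hv, by simp⟩, by simp⟩

theorem chainAut_accepts_final (N n : ℕ) (s : List ℕ) (w : List (List ℕ)) :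
    (chainAut N n).Accepts (n + 2, s) w := by
  induction w with
  | nil => exact ToplC.accepts_nil.2 List.mem_cons_self
  | cons ℓ w ih =>
    exact ToplC.accepts_cons.2 ⟨_, ⟨[], [], by simp [chainAut], by simp [GuardC.Sat], rfl⟩, ih⟩

theorem add_eq_of_chainAut_accepts {N n : ℕ} {φ : ℕ → ℕ} {w : List (List ℕ)}
    (hφ : ∀ ℓ ∈ w, NumSound φ ℓ) {i v : ℕ} (hi : i ≤ n)
    (h : (chainAut N n).Accepts (i + 1, [0, 1, 2, v]) w) : φ v + i = n := by
  induction w generalizing i v with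
  | nil =>
    have := List.mem_singleton.1 (ToplC.accepts_nil.1 h)
    simp only at this
    omega
  | cons ℓ w ih =>
    obtain ⟨hℓ, hw⟩ := List.forall_mem_cons.1 hφ
    obtain ⟨y, hs, h⟩ := ToplC.accepts_cons.1 h
    obtain ⟨rfl, ⟨hin, ht, rfl⟩ | ⟨rfl, ht, -⟩⟩ := (chainAut_step_succ hi).1 hs
    · have := ih hw (i := i + 1) hin h
      rw [hℓ.2 ht]
      omega
    · rw [hℓ.1 ht, zero_add]

theorem chainAut_accepts_chain {K n : ℕ} (hK : 2 ≤ K) (w : List (List ℕ)) (m i : ℕ)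
    (h : m + i = n) : (chainAut (K + 1) n).Accepts (i + 1, [0, 1, 2, m]) (chain K m ++ w) := by
  induction m generalizing i with
  | zero =>
    refine ToplC.accepts_cons.2 ⟨_, (chainAut_step_succ (show i ≤ n by omega)).2
      ⟨(val_letter 0 (assign []) (show 0 < K by omega)).symm, .inr ⟨by omega, rfl, rfl⟩⟩, ?_⟩
    exact chainAut_accepts_final _ _ _ _
  | succ m ih =>
    refine ToplC.accepts_cons.2 ⟨_, (chainAut_step_succ (show i ≤ n by omega)).2
      ⟨(val_letter 1 (assign [m + 1, m]) (show 0 < K by omega)).symm, .inl ⟨by omega, rfl, rfl⟩⟩, ?_⟩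
    rw [val_letter _ _ (by omega)]
    exact ih (i + 1) (by omega)

theorem primrec_chainAut (N : ℕ) : Primrec (chainAut N) := by
  refine (Primrec.of_equiv_iff toplCEquiv).1 ?_
  have succ (k : ℕ) : Primrec fun n : ℕ => n + k := Primrec.nat_add.comp .id (.const k)
  have delta : Primrec fun n => (chainAut N n).delta := by
    refine Primrec.list_cons.comp (.const _) (Primrec.list_cons.comp ?_
      (Primrec.list_cons.comp ?_ (Primrec.list_map Primrec.list_range ?_)))
    · exact (succ 1).pair ((Primrec.const _).pair (succ 2))
    · exact (succ 2).pair ((Primrec.const _).pair (succ 2))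
    · exact ((succ 1).pair ((Primrec.const _).pair (succ 2))).comp .snd
  exact (Primrec.const _).pair ((Primrec.const _).pair ((succ 3).pair ((Primrec.const _).pair
    ((Primrec.const _).pair (delta.pair (Primrec.list_cons.comp (succ 2) (.const [])))))))

theorem exists_inclusion_iff : ∃ (N : ℕ) (B : ToplC), ∀ c : Nat.Partrec.Code,
    ((chainAut N (Encodable.encode c)).WF ∧ B.WF ∧ (chainAut N (Encodable.encode c)).n = B.n ∧
      (chainAut N (Encodable.encode c)).Lang ⊆ B.Lang) ↔ ¬ (c.eval 0).Dom := by
  obtain ⟨R₀, hR₀, hhalt⟩ := definable_haltRel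
  set R : List Rule := ⟨haltRel, [0], [(haltRel, [0])]⟩ :: R₀
  have hR : ∀ r ∈ R, r.Sound := by
    refine List.forall_mem_cons.2 ⟨fun σ h => ?_, hR₀⟩
    exact h _ List.mem_cons_self
  obtain ⟨K, hK, hvars⟩ := exists_varsBelow R
  have hwf := ruleSpec_wf hvars hK
  refine ⟨K + 1, (ruleSpec R K).refuter, fun c => ?_⟩
  refine ((and_iff_right (chainAut_wf _ (by omega))).trans
    ((and_iff_right (Spec.refuter_wf hwf)).trans (and_iff_right rfl))).trans ?_
  rw [iff_not_comm, Iff.comm, Set.not_subset]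
  constructor
  · rintro ⟨w, ⟨hlen, hw⟩, hw'⟩
    have hsat : (ruleSpec R K).Satisfied w := by
      rwa [Spec.mem_lang_refuter hwf hlen, not_not] at hw'
    obtain ⟨φ, hφ⟩ := exists_numSound hsat
    change (chainAut (K + 1) _).Accepts (0, [0, 1, 2, 0]) w at hw
    cases w with
    | nil => simpa [chainAut] using ToplC.accepts_nil.1 hw
    | cons ℓ w =>
      obtain ⟨y, hs, hw⟩ := ToplC.accepts_cons.1 hw
      obtain ⟨ht, rfl⟩ := chainAut_step_zero.1 hs
      have hn : φ (val ℓ 0) = Encodable.encode c :=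
        add_eq_of_chainAut_accepts (List.forall_mem_cons.1 hφ).2 (Nat.zero_le _) hw
      have : [val ℓ 0].map φ ∈ haltRel := mem_of_asserts hR hsat hφ
        ⟨ℓ, List.mem_cons_self, _, by rw [ht]; rfl, rfl, rfl⟩
      obtain ⟨c', hc', h⟩ := this
      rw [List.map_singleton, hn, List.singleton_inj, Encodable.encode_inj] at h
      rwa [h]
  · intro hc
    obtain ⟨wb, hwb, ha⟩ := exists_faithful_of_derives hvars hK
      ((hhalt _ ⟨c, hc, rfl⟩).mono (List.subset_cons_self _ _))
    have hv : val (letter K 2 (assign [Encodable.encode c])) 0 = Encodable.encode c :=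
      val_letter _ _ (by omega)
    have hw : Faithful R K
        (letter K 2 (assign [Encodable.encode c]) :: (chain K (Encodable.encode c) ++ wb)) := by
      refine ((faithful_chain R hK _).1.append hwb).cons
        ⟨by simp [letter], by simp [letter], by simp [letter]⟩ (by simp [letter]) ?_
      intro r hr b hb
      obtain rfl := Option.some.inj hr
      obtain rfl := List.mem_singleton.1 hb
      simpa only [List.map_singleton, hv] using ha.mono (List.subset_append_right _ _)
    have hlen := fun ℓ hℓ => (hw.2 ℓ hℓ).1
    refine ⟨_, ⟨hlen, ?_⟩, fun h => (Spec.mem_lang_refuter hwf hlen).1 h hw.1⟩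
    refine ToplC.accepts_cons.2 ⟨_, chainAut_step_zero.2 ⟨rfl, rfl⟩, ?_⟩
    rw [hv]
    exact chainAut_accepts_chain hK wb _ 0 rfl

/-- The language inclusion problem for TOPL automata (over `V = ℕ`) is undecidable: the set
of (codes of) pairs of well-formed TOPL automata over the same alphabet `V^n` with
`L(A₁) ⊆ L(A₂)` is not a computable predicate. -/
theorem topl_inclusion_undecidable :
    ¬ ComputablePred fun p : ToplC × ToplC =>
        p.1.WF ∧ p.2.WF ∧ p.1.n = p.2.n ∧ p.1.Lang ⊆ p.2.Lang := by
  intro h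
  obtain ⟨N, B, hB⟩ := exists_inclusion_iff
  have hred : (fun c : Nat.Partrec.Code => ¬ (c.eval 0).Dom) ≤₀ fun p : ToplC × ToplC =>
      p.1.WF ∧ p.2.WF ∧ p.1.n = p.2.n ∧ p.1.Lang ⊆ p.2.Lang :=
    ⟨fun c => (chainAut N (Encodable.encode c), B),
      (((primrec_chainAut N).comp Primrec.encode).pair (.const B)).to_comp, fun c => (hB c).symm⟩
  have := (ComputablePred.computable_of_manyOneReducible hred h).not
  exact ComputablePred.halting_problem 0 (this.of_eq fun c => not_not)

end Topl
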